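/- arXiv:1610.07248 — 6 statements merged into one kernel-verified Lean document; each statement's English description precedes it below -/
import Mathlib

section
/- Let d ≥ 1, α ∈ (0,2), C₁ > 0, and let q : (0,1] × ℝ^d → ℝ^d be such that for every t ∈ (0,1] the map x ↦ q(t,x) is differentiable and for all t ∈ (0,1] and x ∈ ℝ^d one has |q(t,x)| ≤ C₁ · ϱ_{α−1}^0(t,x) and |∇q(t,x)| ≤ C₁ · ϱ_{α−2}^0(t,x) (operator norm of the derivative). Then for every ϑ ∈ (0,1) there exists a constant C_ϑ > 0 such that for all t ∈ (0,1] and all x, x' ∈ ℝ^d with |x| ≤ |x'|, |q(t,x) − q(t,x')| ≤ C_ϑ · |x − x'|^ϑ · ϱ_{α−1−ϑ}^0(t,x). -/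
open MeasureTheory

noncomputable abbrev Euc (d : ℕ) := EuclideanSpace ℝ (Fin d)

/-- `ϱ_γ^β(t,x) = t^{γ/α} (|x|^β ∧ 1) (|x| + t^{1/α})^{-d-α}` -/
noncomputable def rho (d : ℕ) (α γ β t : ℝ) (x : Euc d) : ℝ :=
  t ^ (γ / α) * min (‖x‖ ^ β) 1 * (‖x‖ + t ^ (1 / α)) ^ (-(d : ℝ) - α)

lemma rho_zero_eq (d : ℕ) (α γ t : ℝ) (ht : 0 < t) (x : Euc d) :
    rho d α γ 0 t x
      = (t ^ (1 / α)) ^ γ * (‖x‖ + t ^ (1 / α)) ^ (-(d : ℝ) - α) := by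
  unfold rho
  rw [← Real.rpow_mul ht.le, Real.rpow_zero, min_self, mul_one]
  congr 2
  ring

theorem stmt3 (d : ℕ) (hd : 1 ≤ d) (α : ℝ) (hα : α ∈ Set.Ioo (0 : ℝ) 2)
    (C₁ : ℝ) (hC₁ : 0 < C₁)
    (q : ℝ → Euc d → Euc d)
    (hdiff : ∀ t ∈ Set.Ioc (0 : ℝ) 1, Differentiable ℝ (q t))
    (hq : ∀ t ∈ Set.Ioc (0 : ℝ) 1, ∀ x : Euc d, ‖q t x‖ ≤ C₁ * rho d α (α - 1) 0 t x)
    (hq' : ∀ t ∈ Set.Ioc (0 : ℝ) 1, ∀ x : Euc d,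
      ‖fderiv ℝ (q t) x‖ ≤ C₁ * rho d α (α - 2) 0 t x) :
    ∀ ϑ ∈ Set.Ioo (0 : ℝ) 1, ∃ C > (0 : ℝ), ∀ t ∈ Set.Ioc (0 : ℝ) 1,
      ∀ x x' : Euc d, ‖x‖ ≤ ‖x'‖ →
        ‖q t x - q t x'‖ ≤ C * ‖x - x'‖ ^ ϑ * rho d α (α - 1 - ϑ) 0 t x := by
  intro ϑ hϑ
  obtain ⟨hϑ0, hϑ1⟩ := hϑ
  obtain ⟨hα0, hα2⟩ := hα
  have h2N : (0 : ℝ) < 2 ^ ((d : ℝ) + α) := Real.rpow_pos_of_pos two_pos _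
  refine ⟨C₁ * (4 + 2 ^ ((d : ℝ) + α)), by positivity, ?_⟩
  intro t ht x x' hxx
  have hq1 := hq t ht
  have hq2 := hq' t ht
  have hd1 := hdiff t ht
  simp only [rho_zero_eq d α _ t ht.1] at hq1 hq2 ⊢
  have hs : 0 < t ^ (1 / α) := Real.rpow_pos_of_pos ht.1 _
  generalize t ^ (1 / α) = s at *
  have hNneg : -(d : ℝ) - α ≤ 0 := by
    have : (0 : ℝ) ≤ d := Nat.cast_nonneg d
    linarith
  have hxs : 0 < ‖x‖ + s := by positivity
  have hR : 0 < (‖x‖ + s) ^ (-(d : ℝ) - α) := Real.rpow_pos_of_pos hxs _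
  set R := (‖x‖ + s) ^ (-(d : ℝ) - α) with hRdef
  have hδ0 : 0 ≤ ‖x - x'‖ := norm_nonneg _
  have hT : 0 < s ^ (α - 1 - ϑ) := Real.rpow_pos_of_pos hs _
  have hδϑ : 0 ≤ ‖x - x'‖ ^ ϑ := Real.rpow_nonneg hδ0 _
  have hnn : 0 ≤ C₁ * ‖x - x'‖ ^ ϑ * (s ^ (α - 1 - ϑ) * R) := by positivity
  rcases le_or_gt (s / 2) ‖x - x'‖ with hcase | hcase
  · have hsplit : s ^ (α - 1) = s ^ (α - 1 - ϑ) * s ^ ϑ := by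
      rw [← Real.rpow_add hs]; congr 1; ring
    have hsϑ : s ^ ϑ ≤ 2 * ‖x - x'‖ ^ ϑ := by
      calc s ^ ϑ ≤ (2 * ‖x - x'‖) ^ ϑ :=
            Real.rpow_le_rpow hs.le (by linarith) hϑ0.le
        _ = 2 ^ ϑ * ‖x - x'‖ ^ ϑ := Real.mul_rpow two_pos.le hδ0
        _ ≤ 2 * ‖x - x'‖ ^ ϑ := by
            gcongr
            calc (2 : ℝ) ^ ϑ ≤ 2 ^ (1 : ℝ) :=
                  Real.rpow_le_rpow_of_exponent_le one_le_two hϑ1.le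
              _ = 2 := Real.rpow_one 2
    have hx'R : (‖x'‖ + s) ^ (-(d : ℝ) - α) ≤ R :=
      Real.rpow_le_rpow_of_nonpos hxs (by linarith) hNneg
    have hA : 0 < s ^ (α - 1) := Real.rpow_pos_of_pos hs _
    calc ‖q t x - q t x'‖ ≤ ‖q t x‖ + ‖q t x'‖ := norm_sub_le _ _
      _ ≤ C₁ * (s ^ (α - 1) * R) + C₁ * (s ^ (α - 1) * R) := by
          refine add_le_add (hq1 x) ((hq1 x').trans ?_)
          gcongr
      _ = 2 * C₁ * (s ^ (α - 1 - ϑ) * R) * s ^ ϑ := by rw [hsplit]; ring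
      _ ≤ 2 * C₁ * (s ^ (α - 1 - ϑ) * R) * (2 * ‖x - x'‖ ^ ϑ) := by gcongr
      _ = 4 * (C₁ * ‖x - x'‖ ^ ϑ * (s ^ (α - 1 - ϑ) * R)) := by ring
      _ ≤ (4 + 2 ^ ((d : ℝ) + α)) * (C₁ * ‖x - x'‖ ^ ϑ * (s ^ (α - 1 - ϑ) * R)) := by
          gcongr; linarith
      _ = _ := by ring
  · have hB : 0 < s ^ (α - 2) := Real.rpow_pos_of_pos hs _
    have hbound : ∀ z ∈ Metric.closedBall x ‖x - x'‖,
        ‖fderiv ℝ (q t) z‖ ≤ C₁ * (s ^ (α - 2) * (2 ^ ((d : ℝ) + α) * R)) := by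
      intro z hz
      refine (hq2 z).trans ?_
      have hz' : ‖x - z‖ ≤ ‖x - x'‖ := by
        rw [Metric.mem_closedBall, dist_comm, dist_eq_norm] at hz
        exact hz
      have hxz : ‖x‖ - ‖z‖ ≤ ‖x - z‖ := norm_sub_norm_le x z
      have hx0 := norm_nonneg x
      have hz1 : (‖z‖ + s) ^ (-(d : ℝ) - α) ≤ 2 ^ ((d : ℝ) + α) * R := by
        calc (‖z‖ + s) ^ (-(d : ℝ) - α) ≤ (2⁻¹ * (‖x‖ + s)) ^ (-(d : ℝ) - α) :=
              Real.rpow_le_rpow_of_nonpos (by positivity) (by linarith) hNneg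
          _ = 2⁻¹ ^ (-(d : ℝ) - α) * R := Real.mul_rpow (by norm_num) hxs.le
          _ = 2 ^ ((d : ℝ) + α) * R := by
              rw [Real.inv_rpow two_pos.le, ← Real.rpow_neg two_pos.le]
              congr 2; ring
      gcongr
    have hmv := (convex_closedBall x ‖x - x'‖).norm_image_sub_le_of_norm_fderiv_le
      (𝕜 := ℝ) (f := q t) (fun z _ => hd1 z) hbound
      (show x' ∈ _ by rw [Metric.mem_closedBall, dist_comm, dist_eq_norm])
      (Metric.mem_closedBall_self hδ0)
    have hδs : ‖x - x'‖ ≤ ‖x - x'‖ ^ ϑ * s ^ (1 - ϑ) := by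
      calc ‖x - x'‖ = ‖x - x'‖ ^ ϑ * ‖x - x'‖ ^ (1 - ϑ) := by
            rw [← Real.rpow_add_of_nonneg hδ0 hϑ0.le (by linarith)]
            simp
        _ ≤ _ := by
            gcongr
            · linarith
    have hsplit : s ^ (α - 1 - ϑ) = s ^ (α - 2) * s ^ (1 - ϑ) := by
      rw [← Real.rpow_add hs]; congr 1; ring
    calc ‖q t x - q t x'‖
        ≤ C₁ * (s ^ (α - 2) * (2 ^ ((d : ℝ) + α) * R)) * ‖x - x'‖ := hmv
      _ ≤ C₁ * (s ^ (α - 2) * (2 ^ ((d : ℝ) + α) * R))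
            * (‖x - x'‖ ^ ϑ * s ^ (1 - ϑ)) := by gcongr
      _ = 2 ^ ((d : ℝ) + α) * (C₁ * ‖x - x'‖ ^ ϑ * (s ^ (α - 1 - ϑ) * R)) := by
          rw [hsplit]; ring
      _ ≤ (4 + 2 ^ ((d : ℝ) + α)) * (C₁ * ‖x - x'‖ ^ ϑ * (s ^ (α - 1 - ϑ) * R)) := by
          gcongr; linarith
      _ = _ := by ring
end

section
/- Let d ≥ 1, α ∈ (0,2), β ∈ (0,α) and γ ∈ ℝ. Then there exists a constant C > 0 such that for all t ∈ (0,1], ∫_{ℝ^d} ϱ_{−γ}^{β}(t,x) dx ≤ C · t^{(β−γ)/α − 1}. -/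
open MeasureTheory

theorem stmt4 (d : ℕ) (hd : 1 ≤ d) (α β γ : ℝ) (hα : α ∈ Set.Ioo (0 : ℝ) 2)
    (hβ : β ∈ Set.Ioo (0 : ℝ) α) :
    ∃ C > (0 : ℝ), ∀ t ∈ Set.Ioc (0 : ℝ) 1,
      ∫ x : Euc d, rho d α (-γ) β t x ≤ C * t ^ ((β - γ) / α - 1) := by
  obtain ⟨hα0, -⟩ := hα
  obtain ⟨hβ0, hβα⟩ := hβ
  set r : ℝ := d + α - β with hr
  have hfin : (Module.finrank ℝ (Euc d) : ℝ) < r := by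
    rw [finrank_euclideanSpace_fin]; linarith
  have hint : Integrable (fun x : Euc d => (1 + ‖x‖) ^ (-r)) volume :=
    integrable_one_add_norm hfin
  set K : ℝ := ∫ x : Euc d, (1 + ‖x‖) ^ (-r) with hK
  have hK0 : 0 ≤ K := integral_nonneg fun x => by positivity
  refine ⟨K + 1, by linarith, ?_⟩
  rintro t ⟨ht, -⟩
  set s : ℝ := t ^ (1 / α) with hs
  have hs0 : 0 < s := Real.rpow_pos_of_pos ht _
  have hbound : ∀ x : Euc d, rho d α (-γ) β t x ≤
      t ^ (-γ / α) * s ^ (-r) * (1 + ‖s⁻¹ • x‖) ^ (-r) := by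
    intro x
    have hx := norm_nonneg x
    have h0 : 0 < ‖x‖ + s := by linarith
    have h1 : s * (1 + ‖s⁻¹ • x‖) = ‖x‖ + s := by
      rw [norm_smul, Real.norm_of_nonneg (inv_nonneg.2 hs0.le)]
      field_simp
      ring
    rw [mul_assoc, ← Real.mul_rpow hs0.le (by positivity), h1]
    unfold rho
    rw [← hs, mul_assoc]
    refine mul_le_mul_of_nonneg_left ?_ (by positivity)
    have h2 : (‖x‖ + s) ^ (-r) = (‖x‖ + s) ^ β * (‖x‖ + s) ^ (-(d : ℝ) - α) := by
      rw [← Real.rpow_add h0]; congr 1; rw [hr]; ring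
    rw [h2]
    refine mul_le_mul_of_nonneg_right ?_ (by positivity)
    exact (min_le_left _ _).trans (Real.rpow_le_rpow hx (by linarith) hβ0.le)
  have hint2 : Integrable (fun x : Euc d =>
      t ^ (-γ / α) * s ^ (-r) * (1 + ‖s⁻¹ • x‖) ^ (-r)) volume :=
    (hint.comp_smul (inv_ne_zero hs0.ne')).const_mul _
  have hexp : t ^ (-γ / α) * s ^ (-r) * s ^ d = t ^ ((β - γ) / α - 1) := by
    rw [← Real.rpow_natCast s d, hs, ← Real.rpow_mul ht.le, ← Real.rpow_mul ht.le,
      ← Real.rpow_add ht, ← Real.rpow_add ht]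
    congr 1
    rw [hr]
    field_simp
    ring
  calc ∫ x : Euc d, rho d α (-γ) β t x
      ≤ ∫ x : Euc d, t ^ (-γ / α) * s ^ (-r) * (1 + ‖s⁻¹ • x‖) ^ (-r) := by
        refine integral_mono_of_nonneg (Filter.Eventually.of_forall fun x => ?_) hint2
          (Filter.Eventually.of_forall hbound)
        have := norm_nonneg x
        simp only [Pi.zero_apply, rho]
        positivity
    _ = t ^ ((β - γ) / α - 1) * K := by
        rw [integral_const_mul, Measure.integral_comp_inv_smul_of_nonneg volume
          (fun x : Euc d => (1 + ‖x‖) ^ (-r)) hs0.le, finrank_euclideanSpace_fin, smul_eq_mul,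
          ← mul_assoc, hexp]
    _ ≤ (K + 1) * t ^ ((β - γ) / α - 1) := by
        have : 0 < t ^ ((β - γ) / α - 1) := Real.rpow_pos_of_pos ht _
        linarith
end

section
/- Let d ≥ 1, α ∈ (1,2), β ∈ (0,1) with α + β < 2, let γ ∈ [0,β) and γ' ∈ (0, β−γ). Let P, Q : (0,1] × ℝ^d × ℝ^d → ℝ be measurable and let C₀ > 0 be such that for all t ∈ (0,1] and all x, y, z ∈ ℝ^d: (i) |P(t,x,z)| ≤ C₀ · ϱ_{−γ}^0(t, x−z); (ii) | ∫_{ℝ^d} P(t,x,z) dz | ≤ C₀ · t^{(β−γ)/α − 1}; (iii) |Q(t,z,y)| ≤ C₀ · ( ϱ_0^β + ϱ_β^0 )(t, z−y); (iv) |Q(t,z,y) − Q(t,x,y)| ≤ C₀ · min(|z−x|^{β−γ'}, 1) · [ ( ϱ_{γ'}^0 + ϱ_{γ'−β}^β )(t, z−y) + ( ϱ_{γ'}^0 + ϱ_{γ'−β}^β )(t, x−y) ]. Then there exists a constant C > 0 such that for all t ∈ (0,1] and all x, y ∈ ℝ^d, | ∫₀^t ∫_{ℝ^d} P(t−s, x,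 z) · Q(s, z, y) dz ds | ≤ C · ϱ_{−γ}^0(t, x−y). -/
open MeasureTheory

noncomputable def kk (d : ℕ) (α δ τ : ℝ) (z : Euc d) : ℝ :=
  min (‖z‖ ^ δ) 1 * (‖z‖ + τ ^ (1 / α)) ^ (-(d : ℝ) - α)

noncomputable def JJ (d : ℕ) (α δ : ℝ) : ℝ :=
  ∫ x : Euc d, (1 + ‖x‖) ^ (-((d : ℝ) + α - δ))

lemma rho_eq (d : ℕ) (α γ β t : ℝ) (x : Euc d) :
    rho d α γ β t x = t ^ (γ / α) * kk d α β t x := by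
  unfold rho kk; ring

lemma kk_nonneg (d : ℕ) (α δ τ : ℝ) (hτ : 0 ≤ τ) (z : Euc d) : 0 ≤ kk d α δ τ z := by
  unfold kk; positivity

lemma JJ_nonneg (d : ℕ) (α δ : ℝ) : 0 ≤ JJ d α δ := by
  unfold JJ; exact integral_nonneg fun x => by positivity

lemma kk_zero (d : ℕ) (α τ : ℝ) (z : Euc d) :
    kk d α 0 τ z = (‖z‖ + τ ^ (1 / α)) ^ (-(d : ℝ) - α) := by
  simp [kk]

lemma kk_le (d : ℕ) (α δ τ : ℝ) (hτ : 0 ≤ τ) (z : Euc d) : kk d α δ τ z ≤ kk d α 0 τ z := by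
  rw [kk_zero]
  exact mul_le_of_le_one_left (by positivity) (min_le_right _ _)

lemma kk_pos (d : ℕ) (α τ : ℝ) (hτ : 0 < τ) (z : Euc d) : 0 < kk d α 0 τ z := by
  unfold kk
  have : 0 < τ ^ (1 / α) := Real.rpow_pos_of_pos hτ _
  simp only [Real.rpow_zero, min_self, one_mul]
  positivity

lemma kk_meas (d : ℕ) (α δ τ : ℝ) : Measurable (kk d α δ τ) := by
  unfold kk; fun_prop

lemma base_int (d : ℕ) (e r : ℝ) (he : 0 < e) (hr : 0 < r) :
    Integrable (fun x : Euc d => (‖x‖ + r) ^ (-((d : ℝ) + e))) ∧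
    ∫ x : Euc d, (‖x‖ + r) ^ (-((d : ℝ) + e)) =
      r ^ (-e) * ∫ x : Euc d, (1 + ‖x‖) ^ (-((d : ℝ) + e)) := by
  have h0 : Integrable (fun x : Euc d => (1 + ‖x‖) ^ (-((d : ℝ) + e))) := by
    apply integrable_one_add_norm
    simp; exact he
  have heq : (fun x : Euc d => (‖x‖ + r) ^ (-((d : ℝ) + e))) =
      fun x => r ^ (-((d : ℝ) + e)) * (1 + ‖r⁻¹ • x‖) ^ (-((d : ℝ) + e)) := by
    funext x
    rw [← Real.mul_rpow hr.le (by positivity), norm_smul, Real.norm_of_nonneg (by positivity)]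
    congr 1
    field_simp
    ring
  rw [heq]
  refine ⟨(h0.comp_smul (inv_ne_zero hr.ne')).const_mul _, ?_⟩
  rw [integral_const_mul,
    Measure.integral_comp_inv_smul volume (fun x : Euc d => (1 + ‖x‖) ^ (-((d : ℝ) + e))) r]
  rw [smul_eq_mul, ← mul_assoc]
  congr 1
  simp only [finrank_euclideanSpace, Fintype.card_fin]
  rw [abs_of_pos (by positivity), ← Real.rpow_natCast, ← Real.rpow_add hr]
  congr 1; ring

lemma kk_bd (d : ℕ) (α δ τ : ℝ) (hδ : 0 ≤ δ) (hτ : 0 < τ) (z : Euc d) :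
    kk d α δ τ z ≤ (‖z‖ + τ ^ (1 / α)) ^ (-((d : ℝ) + (α - δ))) := by
  unfold kk
  have h : 0 < τ ^ (1 / α) := Real.rpow_pos_of_pos hτ _
  have h2 : -((d : ℝ) + (α - δ)) = δ + (-(d : ℝ) - α) := by ring
  rw [h2, Real.rpow_add (by positivity)]
  gcongr
  refine (min_le_left _ _).trans ?_
  gcongr
  linarith

lemma kk_int (d : ℕ) (α δ τ : ℝ) (hα : 0 < α) (hδ : 0 ≤ δ) (hδα : δ < α) (hτ : 0 < τ) :
    Integrable (kk d α δ τ) ∧ ∫ z, kk d α δ τ z ≤ JJ d α δ * τ ^ (δ / α - 1) := by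
  have h : 0 < τ ^ (1 / α) := Real.rpow_pos_of_pos hτ _
  obtain ⟨hi, he⟩ := base_int d (α - δ) _ (sub_pos.2 hδα) h
  have hI : Integrable (kk d α δ τ) := by
    refine hi.mono' (kk_meas _ _ _ _).aestronglyMeasurable (Filter.Eventually.of_forall fun z => ?_)
    rw [Real.norm_of_nonneg (kk_nonneg _ _ _ _ hτ.le _)]
    exact kk_bd d α δ τ hδ hτ z
  refine ⟨hI, ?_⟩
  refine (integral_mono hI hi fun z => kk_bd d α δ τ hδ hτ z).trans ?_
  rw [he, ← Real.rpow_mul hτ.le, mul_comm]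
  unfold JJ
  apply le_of_eq
  congr 2
  · simp only [add_sub_assoc]
  · field_simp; ring

lemma kk_int_l (d : ℕ) (α δ τ : ℝ) (hα : 0 < α) (hδ : 0 ≤ δ) (hδα : δ < α) (hτ : 0 < τ)
    (x : Euc d) :
    Integrable (fun z => kk d α δ τ (x - z)) ∧
      ∫ z, kk d α δ τ (x - z) ≤ JJ d α δ * τ ^ (δ / α - 1) := by
  obtain ⟨h1, h2⟩ := kk_int d α δ τ hα hδ hδα hτ
  refine ⟨h1.comp_sub_left x, ?_⟩
  rwa [integral_sub_left_eq_self (kk d α δ τ) volume x]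

lemma kk_int_r (d : ℕ) (α δ τ : ℝ) (hα : 0 < α) (hδ : 0 ≤ δ) (hδα : δ < α) (hτ : 0 < τ)
    (x : Euc d) :
    Integrable (fun z => kk d α δ τ (z - x)) ∧
      ∫ z, kk d α δ τ (z - x) ≤ JJ d α δ * τ ^ (δ / α - 1) := by
  obtain ⟨h1, h2⟩ := kk_int d α δ τ hα hδ hδα hτ
  refine ⟨h1.comp_sub_right x, ?_⟩
  rwa [integral_sub_right_eq_self (kk d α δ τ) x]

lemma half_pow (u w p : ℝ) (hw : 0 < w) (hp : 0 ≤ p) (h : w ≤ 2 * u) :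
    u ^ (-p) ≤ 2 ^ p * w ^ (-p) := by
  have : u ^ (-p) ≤ (w / 2) ^ (-p) :=
    Real.rpow_le_rpow_of_nonpos (by positivity) (by linarith) (by linarith)
  refine this.trans (le_of_eq ?_)
  rw [Real.div_rpow hw.le (by norm_num), Real.rpow_neg (by norm_num : (0:ℝ) ≤ 2)]
  field_simp

lemma kk_3P (d : ℕ) (α ε δ a s : ℝ) (hα : 1 ≤ α) (ha : 0 < a) (hs : 0 < s) (x y z : Euc d) :
    kk d α ε a (x - z) * kk d α δ s (z - y) ≤ 2 ^ ((d : ℝ) + α) * kk d α 0 (a + s) (x - y) *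
      (kk d α ε a (x - z) + kk d α δ s (z - y)) := by
  have h1 : (a + s) ^ (1 / α) ≤ a ^ (1 / α) + s ^ (1 / α) :=
    Real.rpow_add_le_add_rpow ha.le hs.le (by positivity) (by rw [div_le_one (by linarith)]; exact hα)
  have h2 : ‖x - y‖ ≤ ‖x - z‖ + ‖z - y‖ := norm_sub_le_norm_sub_add_norm_sub _ _ _
  have h0 : 0 < (a + s) ^ (1 / α) := Real.rpow_pos_of_pos (by positivity) _
  have hp : (-(d : ℝ) - α) = -((d : ℝ) + α) := by ring
  rw [kk_zero]
  have hA := kk_nonneg d α ε a ha.le (x - z)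
  have hB := kk_nonneg d α δ s hs.le (z - y)
  set W := 2 ^ ((d : ℝ) + α) * (‖x - y‖ + (a + s) ^ (1 / α)) ^ (-(d : ℝ) - α) with hW
  have hW0 : 0 ≤ W := by positivity
  rcases le_total (‖x - z‖ + a ^ (1 / α)) (‖z - y‖ + s ^ (1 / α)) with h | h
  · have : kk d α δ s (z - y) ≤ W := by
      refine (kk_le d α δ s hs.le _).trans ?_
      rw [kk_zero, hW, hp]
      exact half_pow _ _ _ (by positivity) (by positivity) (by linarith)
    nlinarith
  · have : kk d α ε a (x - z) ≤ W := by
      refine (kk_le d α ε a ha.le _).trans ?_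
      rw [kk_zero, hW, hp]
      exact half_pow _ _ _ (by positivity) (by positivity) (by linarith)
    nlinarith

lemma kk_cmp (d : ℕ) (α δ a s : ℝ) (hα : 1 ≤ α) (ha : 0 < a) (hs : 0 < s) (has : a ≤ s)
    (x : Euc d) :
    kk d α δ s x ≤ 2 ^ ((d : ℝ) + α) * kk d α 0 (a + s) x := by
  have h1 : (a + s) ^ (1 / α) ≤ a ^ (1 / α) + s ^ (1 / α) :=
    Real.rpow_add_le_add_rpow ha.le hs.le (by positivity) (by rw [div_le_one (by linarith)]; exact hα)
  have h2 : a ^ (1 / α) ≤ s ^ (1 / α) := by gcongr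
  have h0 : 0 < (a + s) ^ (1 / α) := Real.rpow_pos_of_pos (by positivity) _
  have hp : (-(d : ℝ) - α) = -((d : ℝ) + α) := by ring
  refine (kk_le d α δ s hs.le _).trans ?_
  rw [kk_zero, kk_zero, hp]
  exact half_pow _ _ _ (by positivity) (by positivity) (by linarith [norm_nonneg x])

lemma time_s (t e1 e2 g : ℝ) (ht : 0 < t) (ht1 : t ≤ 1) (he1 : 0 < e1) (hg : g ≤ e1 + e2) :
    IntegrableOn (fun s : ℝ => s ^ (e1 - 1) * (t / 2) ^ e2) (Set.Ioo 0 t) ∧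
    ∫ s in Set.Ioo 0 t, s ^ (e1 - 1) * (t / 2) ^ e2 ≤ (2 ^ (-e2) / e1) * t ^ g := by
  have hi : IntervalIntegrable (fun s : ℝ => s ^ (e1 - 1)) volume 0 t :=
    intervalIntegral.intervalIntegrable_rpow' (by linarith)
  have h2 : IntegrableOn (fun s : ℝ => s ^ (e1 - 1)) (Set.Ioo 0 t) := by
    rw [intervalIntegrable_iff_integrableOn_Ioo_of_le ht.le] at hi
    exact hi
  refine ⟨h2.mul_const _, ?_⟩
  rw [integral_mul_const, ← integral_Ioc_eq_integral_Ioo, ← intervalIntegral.integral_of_le ht.le,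
    integral_rpow (Or.inl (by linarith))]
  rw [sub_add_cancel, Real.zero_rpow he1.ne', sub_zero, Real.div_rpow ht.le (by norm_num),
    Real.rpow_neg (by norm_num)]
  have : t ^ (e1 + e2) ≤ t ^ g := Real.rpow_le_rpow_of_exponent_ge ht ht1 hg
  rw [Real.rpow_add ht] at this
  calc t ^ e1 / e1 * (t ^ e2 / 2 ^ e2) = ((2 ^ e2)⁻¹ / e1) * (t ^ e1 * t ^ e2) := by
        field_simp
    _ ≤ _ := by gcongr

lemma time_a (t e1 e2 g : ℝ) (ht : 0 < t) (ht1 : t ≤ 1) (he1 : 0 < e1) (hg : g ≤ e1 + e2) :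
    IntegrableOn (fun s : ℝ => (t - s) ^ (e1 - 1) * (t / 2) ^ e2) (Set.Ioo 0 t) ∧
    ∫ s in Set.Ioo 0 t, (t - s) ^ (e1 - 1) * (t / 2) ^ e2 ≤ (2 ^ (-e2) / e1) * t ^ g := by
  obtain ⟨h1, h2⟩ := time_s t e1 e2 g ht ht1 he1 hg
  rw [← intervalIntegrable_iff_integrableOn_Ioo_of_le ht.le] at h1 ⊢
  rw [← integral_Ioc_eq_integral_Ioo, ← intervalIntegral.integral_of_le ht.le] at h2 ⊢
  refine ⟨?_, ?_⟩
  · have := h1.comp_sub_left t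
    simp only [sub_zero, sub_self] at this
    exact this.symm
  · rw [intervalIntegral.integral_comp_sub_left (fun s : ℝ => s ^ (e1 - 1) * (t / 2) ^ e2) t]
    simpa using h2

lemma gen_int (d : ℕ) (α ε β a s c1 c2 c3 : ℝ) (hα : 0 < α) (hε : 0 ≤ ε) (hεα : ε < α)
    (hβ : 0 ≤ β) (hβα : β < α) (ha : 0 < a) (hs : 0 < s) (hc1 : 0 ≤ c1) (hc2 : 0 ≤ c2)
    (hc3 : 0 ≤ c3) (x y : Euc d) (f : Euc d → ℝ)
    (hf : ∀ z, |f z| ≤ c1 * kk d α ε a (x - z) + c2 * kk d α 0 s (z - y)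
      + c3 * kk d α β s (z - y)) :
    Integrable (fun z => c1 * kk d α ε a (x - z) + c2 * kk d α 0 s (z - y)
      + c3 * kk d α β s (z - y)) ∧
    |∫ z, f z| ≤ c1 * (JJ d α ε * a ^ (ε / α - 1)) + c2 * (JJ d α 0 * s ^ (-1 : ℝ))
      + c3 * (JJ d α β * s ^ (β / α - 1)) := by
  obtain ⟨i1, b1⟩ := kk_int_l d α ε a hα hε hεα ha x
  obtain ⟨i2, b2⟩ := kk_int_r d α 0 s hα le_rfl hα hs y
  obtain ⟨i3, b3⟩ := kk_int_r d α β s hα hβ hβα hs y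
  rw [zero_div, zero_sub] at b2
  have i12 := (i1.const_mul c1).add (i2.const_mul c2)
  have i123 := i12.add (i3.const_mul c3)
  refine ⟨i123, ?_⟩
  have h := norm_integral_le_of_norm_le (f := f) i123 (Filter.Eventually.of_forall hf)
  rw [Real.norm_eq_abs] at h
  refine h.trans ?_
  rw [integral_add' i12 (i3.const_mul c3),
    integral_add' (i1.const_mul c1) (i2.const_mul c2),
    integral_const_mul, integral_const_mul, integral_const_mul]
  gcongr

lemma case1 (d : ℕ) (α β a s A C₀ : ℝ) (hα : 1 < α) (hβ : 0 < β) (hβα : β < α) (ha : 0 < a)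
    (hs : 0 < s) (hs1 : s ≤ 1) (hA : 0 ≤ A) (hC : 0 < C₀) (x y : Euc d) (p q : Euc d → ℝ)
    (hp : ∀ z, |p z| ≤ C₀ * (A * kk d α 0 a (x - z)))
    (hq : ∀ z, |q z| ≤ C₀ * (kk d α β s (z - y) + s ^ (β / α) * kk d α 0 s (z - y))) :
    |∫ z, p z * q z| ≤ (C₀ ^ 2 * 2 ^ ((d : ℝ) + α) * kk d α 0 (a + s) (x - y)) *
      (2 * JJ d α 0 * (A * a ^ (-1 : ℝ)) + (JJ d α 0 + JJ d α β) * (A * s ^ (β / α - 1))) := by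
  set K := 2 ^ ((d : ℝ) + α) * kk d α 0 (a + s) (x - y) with hK
  have hK0 : 0 ≤ K := mul_nonneg (by positivity) (kk_nonneg _ _ _ _ (by positivity) _)
  set S := s ^ (β / α) with hS
  have hα0 : 0 < α := by linarith
  have hS1 : S ≤ 1 := Real.rpow_le_one hs.le hs1 (by positivity)
  have hS0 : 0 ≤ S := by positivity
  have key := (gen_int d α 0 β a s (C₀ ^ 2 * A * K * 2) (C₀ ^ 2 * A * K * S) (C₀ ^ 2 * A * K)
    (by linarith) le_rfl (by linarith) hβ.le hβα ha hs (by positivity) (by positivity)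
    (by positivity) x y (fun z => p z * q z) ?_).2
  · refine key.trans (le_of_eq ?_)
    have : S * s ^ (-1 : ℝ) = s ^ (β / α - 1) := by
      rw [hS, ← Real.rpow_add hs]; rfl
    rw [← this, hK, zero_div, zero_sub]
    ring
  · intro z
    have n1 := kk_nonneg d α 0 a ha.le (x - z)
    have n2 := kk_nonneg d α 0 s hs.le (z - y)
    have n3 := kk_nonneg d α β s hs.le (z - y)
    have t1 := kk_3P d α 0 0 a s hα.le ha hs x y z
    have t2 := kk_3P d α 0 β a s hα.le ha hs x y z
    rw [← hK] at t1 t2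
    rw [abs_mul]
    calc |p z| * |q z| ≤ C₀ * (A * kk d α 0 a (x - z)) *
          (C₀ * (kk d α β s (z - y) + S * kk d α 0 s (z - y))) := by
          gcongr
          · exact hp z
          · exact hq z
      _ = C₀ ^ 2 * A * (kk d α 0 a (x - z) * kk d α β s (z - y)
            + S * (kk d α 0 a (x - z) * kk d α 0 s (z - y))) := by ring
      _ ≤ C₀ ^ 2 * A * (K * (kk d α 0 a (x - z) + kk d α β s (z - y))
            + S * (K * (kk d α 0 a (x - z) + kk d α 0 s (z - y)))) := by
          gcongr
      _ = C₀ ^ 2 * A * K * ((1 + S) * kk d α 0 a (x - z) + S * kk d α 0 s (z - y)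
            + kk d α β s (z - y)) := by ring
      _ ≤ C₀ ^ 2 * A * K * (2 * kk d α 0 a (x - z) + S * kk d α 0 s (z - y)
            + kk d α β s (z - y)) := by
          gcongr
          linarith
      _ = _ := by ring

lemma kk_min (d : ℕ) (α η a : ℝ) (x z : Euc d) :
    kk d α η a (x - z) = min (‖z - x‖ ^ η) 1 * kk d α 0 a (x - z) := by
  rw [kk_zero, kk, norm_sub_rev x z]

lemma case2 (d : ℕ) (α β γ' a s A R C₀ : ℝ) (hα : 1 < α) (hβ : 0 < β) (hβα : β < α)
    (hγ' : 0 < γ') (hγβ : γ' < β) (ha : 0 < a)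
    (hs : 0 < s) (hs1 : s ≤ 1) (has : a ≤ s) (hA : 0 ≤ A) (hR : 0 ≤ R) (hC : 0 < C₀)
    (x y : Euc d) (p q : Euc d → ℝ) (hpm : Measurable p) (hqm : Measurable q)
    (hp : ∀ z, |p z| ≤ C₀ * (A * kk d α 0 a (x - z)))
    (hp2 : |∫ z, p z| ≤ C₀ * R)
    (hq : ∀ z, |q z| ≤ C₀ * (kk d α β s (z - y) + s ^ (β / α) * kk d α 0 s (z - y)))
    (hq2 : ∀ z, |q z - q x| ≤ C₀ * min (‖z - x‖ ^ (β - γ')) 1 *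
      ((s ^ (γ' / α) * kk d α 0 s (z - y) + s ^ ((γ' - β) / α) * kk d α β s (z - y)) +
      (s ^ (γ' / α) * kk d α 0 s (x - y) + s ^ ((γ' - β) / α) * kk d α β s (x - y)))) :
    |∫ z, p z * q z| ≤ (C₀ ^ 2 * 2 ^ ((d : ℝ) + α) * kk d α 0 (a + s) (x - y)) *
      (2 * R + 4 * JJ d α (β - γ') * (A * a ^ ((β - γ') / α - 1) * s ^ ((γ' - β) / α))
        + (JJ d α 0 + JJ d α β) * (A * s ^ (γ' / α - 1))) := by
  set K := 2 ^ ((d : ℝ) + α) * kk d α 0 (a + s) (x - y) with hK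
  have hK0 : 0 ≤ K := mul_nonneg (by positivity) (kk_nonneg _ _ _ _ (by positivity) _)
  have hα0 : 0 < α := by linarith
  set S := s ^ (β / α) with hS
  have hS1 : S ≤ 1 := Real.rpow_le_one hs.le hs1 (by positivity)
  have hS0 : 0 ≤ S := by positivity
  set G := s ^ (γ' / α) with hG
  set B := s ^ ((γ' - β) / α) with hB
  set η := β - γ' with hη
  have hG0 : 0 ≤ G := by positivity
  have hB0 : 0 ≤ B := by positivity
  have hGB : G ≤ B := by
    apply Real.rpow_le_rpow_of_exponent_ge hs hs1
    gcongr
    linarith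
  have m0 : kk d α 0 s (x - y) ≤ K := kk_cmp d α 0 a s hα.le ha hs has _
  have mβ : kk d α β s (x - y) ≤ K := kk_cmp d α β a s hα.le ha hs has _
  -- the difference term
  have hbd : ∀ z, |p z * (q z - q x)| ≤ (C₀ ^ 2 * A * K * (4 * B)) * kk d α η a (x - z)
      + (C₀ ^ 2 * A * K * G) * kk d α 0 s (z - y) + (C₀ ^ 2 * A * K * B) * kk d α β s (z - y) := by
    intro z
    have n1 := kk_nonneg d α 0 a ha.le (x - z)
    have n1' := kk_nonneg d α η a ha.le (x - z)
    have n2 := kk_nonneg d α 0 s hs.le (z - y)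
    have n3 := kk_nonneg d α β s hs.le (z - y)
    have n4 := kk_nonneg d α 0 s hs.le (x - y)
    have t1 := kk_3P d α η 0 a s hα.le ha hs x y z
    have t2 := kk_3P d α η β a s hα.le ha hs x y z
    rw [← hK] at t1 t2
    have hm : 0 ≤ min (‖z - x‖ ^ η) 1 := by positivity
    rw [abs_mul]
    calc |p z| * |q z - q x| ≤ C₀ * (A * kk d α 0 a (x - z)) *
          (C₀ * min (‖z - x‖ ^ η) 1 *
      ((G * kk d α 0 s (z - y) + B * kk d α β s (z - y)) +
      (G * kk d α 0 s (x - y) + B * kk d α β s (x - y)))) := by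
          gcongr
          · exact hp z
          · exact hq2 z
      _ ≤ C₀ * (A * kk d α 0 a (x - z)) *
          (C₀ * min (‖z - x‖ ^ η) 1 *
      ((G * kk d α 0 s (z - y) + B * kk d α β s (z - y)) +
      (B * K + B * K))) := by
          gcongr
      _ = C₀ ^ 2 * A * (G * (kk d α η a (x - z) * kk d α 0 s (z - y))
            + B * (kk d α η a (x - z) * kk d α β s (z - y))
            + 2 * B * K * kk d α η a (x - z)) := by rw [kk_min d α η a x z]; ring
      _ ≤ C₀ ^ 2 * A * (G * (K * (kk d α η a (x - z) + kk d α 0 s (z - y)))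
            + B * (K * (kk d α η a (x - z) + kk d α β s (z - y)))
            + 2 * B * K * kk d α η a (x - z)) := by
          gcongr
      _ = C₀ ^ 2 * A * (K * ((G + 3 * B) * kk d α η a (x - z) + G * kk d α 0 s (z - y)
            + B * kk d α β s (z - y))) := by ring
      _ ≤ C₀ ^ 2 * A * (K * ((4 * B) * kk d α η a (x - z) + G * kk d α 0 s (z - y)
            + B * kk d α β s (z - y))) := by
          gcongr
          linarith
      _ = _ := by ring
  obtain ⟨hi, key⟩ := gen_int d α η β a s _ _ _ hα0 (by linarith) (by linarith) hβ.le hβα ha hs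
    (by positivity) (by positivity) (by positivity) x y (fun z => p z * (q z - q x)) hbd
  have hdi : Integrable (fun z => p z * (q z - q x)) :=
    hi.mono' (hpm.mul (hqm.sub_const _)).aestronglyMeasurable (Filter.Eventually.of_forall hbd)
  have hpi : Integrable p :=
    (((kk_int_l d α 0 a hα0 le_rfl hα0 ha x).1.const_mul A).const_mul C₀).mono'
      hpm.aestronglyMeasurable (Filter.Eventually.of_forall hp)
  have hsplit : ∫ z, p z * q z = (∫ z, p z * (q z - q x)) + (∫ z, p z) * q x := by
    rw [← integral_mul_const, ← integral_add hdi (hpi.mul_const _)]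
    congr 1; funext z; ring
  have hqx : |q x| ≤ C₀ * (K + 1 * K) := by
    refine (hq x).trans ?_
    have := kk_nonneg d α 0 s hs.le (x - y)
    gcongr
  have h2 : |(∫ z, p z) * q x| ≤ C₀ * R * (C₀ * (K + 1 * K)) := by
    rw [abs_mul]; gcongr
  rw [hsplit]
  refine (abs_add_le _ _).trans ((add_le_add key h2).trans (le_of_eq ?_))
  have e1 : G * s ^ (-1 : ℝ) = s ^ (γ' / α - 1) := by
    rw [hG, ← Real.rpow_add hs]; rfl
  have e2 : B * s ^ (β / α - 1) = s ^ (γ' / α - 1) := by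
    rw [hB, ← Real.rpow_add hs]; congr 1; ring
  rw [mul_assoc (C₀ ^ 2) (2 ^ _), ← hK]
  linear_combination (C₀ ^ 2 * A * K * JJ d α 0) * e1 + (C₀ ^ 2 * A * K * JJ d α β) * e2

theorem stmt5 (d : ℕ) (hd : 1 ≤ d) (α β : ℝ) (hα : α ∈ Set.Ioo (1 : ℝ) 2)
    (hβ : β ∈ Set.Ioo (0 : ℝ) 1) (hαβ : α + β < 2)
    (γ γ' : ℝ) (hγ : γ ∈ Set.Ico (0 : ℝ) β) (hγ' : γ' ∈ Set.Ioo (0 : ℝ) (β - γ))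
    (P Q : ℝ → Euc d → Euc d → ℝ)
    (hP : Measurable fun r : ℝ × Euc d × Euc d => P r.1 r.2.1 r.2.2)
    (hQ : Measurable fun r : ℝ × Euc d × Euc d => Q r.1 r.2.1 r.2.2)
    (C₀ : ℝ) (hC₀ : 0 < C₀)
    (h1 : ∀ t ∈ Set.Ioc (0 : ℝ) 1, ∀ x z : Euc d, |P t x z| ≤ C₀ * rho d α (-γ) 0 t (x - z))
    (h2 : ∀ t ∈ Set.Ioc (0 : ℝ) 1, ∀ x : Euc d,
      |∫ z, P t x z| ≤ C₀ * t ^ ((β - γ) / α - 1))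
    (h3 : ∀ t ∈ Set.Ioc (0 : ℝ) 1, ∀ z y : Euc d,
      |Q t z y| ≤ C₀ * (rho d α 0 β t (z - y) + rho d α β 0 t (z - y)))
    (h4 : ∀ t ∈ Set.Ioc (0 : ℝ) 1, ∀ x z y : Euc d,
      |Q t z y - Q t x y| ≤ C₀ * min (‖z - x‖ ^ (β - γ')) 1 *
        ((rho d α γ' 0 t (z - y) + rho d α (γ' - β) β t (z - y))
          + (rho d α γ' 0 t (x - y) + rho d α (γ' - β) β t (x - y)))) :
    ∃ C > (0 : ℝ), ∀ t ∈ Set.Ioc (0 : ℝ) 1, ∀ x y : Euc d,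
      |∫ s in Set.Ioo (0 : ℝ) t, ∫ z, P (t - s) x z * Q s z y|
        ≤ C * rho d α (-γ) 0 t (x - y) := by
  obtain ⟨hα1, hα2⟩ := hα
  obtain ⟨hβ0, hβ1⟩ := hβ
  obtain ⟨hγ0, hγβ⟩ := hγ
  obtain ⟨hγ'0, hγ'β⟩ := hγ'
  have hα0 : 0 < α := by linarith
  have hJ0 := JJ_nonneg d α 0
  have hJβ := JJ_nonneg d α β
  have hJη := JJ_nonneg d α (β - γ')
  set M := 2 + 2 * JJ d α 0 + 4 * JJ d α (β - γ') + JJ d α β with hM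
  have hM0 : 0 < M := by positivity
  set D := C₀ ^ 2 * 2 ^ ((d : ℝ) + α) with hD
  have hD0 : 0 < D := by positivity
  have hγα : γ / α < 1 := by rw [div_lt_one hα0]; linarith
  set N : ℝ := 2 ^ (-(-γ / α - 1)) / 1 + 2 ^ (-(-γ / α)) / (β / α) + 2 ^ (-(0 : ℝ)) / ((β - γ) / α)
    + 2 ^ (-((γ' - β) / α)) / ((β - γ' - γ) / α) + 2 ^ (-(γ' / α - 1)) / (1 - γ / α) with hN
  have hβγ : 0 < (β - γ) / α := div_pos (by linarith) hα0
  have hβγ' : 0 < (β - γ' - γ) / α := div_pos (by linarith) hα0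
  have hβα : 0 < β / α := by positivity
  have hγ'α : 0 < γ' / α := by positivity
  have h1γ : 0 < 1 - γ / α := by linarith
  have hN0 : 0 < N := by positivity
  refine ⟨D * M * N, by positivity, ?_⟩
  rintro t ⟨ht0, ht1⟩ x y
  have hg : -γ / α = -(γ / α) := by ring
  obtain ⟨i1, b1⟩ := time_s t 1 (-γ / α - 1) (-γ / α) ht0 ht1 one_pos (by linarith)
  obtain ⟨i2, b2⟩ := time_s t (β / α) (-γ / α) (-γ / α) ht0 ht1 hβα (by linarith)
  obtain ⟨i3, b3⟩ := time_a t ((β - γ) / α) 0 (-γ / α) ht0 ht1 hβγ (by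
    rw [hg]; have : 0 ≤ γ / α := by positivity
    linarith)
  obtain ⟨i4, b4⟩ := time_a t ((β - γ' - γ) / α) ((γ' - β) / α) (-γ / α) ht0 ht1 hβγ'
    (le_of_eq (by ring))
  obtain ⟨i5, b5⟩ := time_a t (1 - γ / α) (γ' / α - 1) (-γ / α) ht0 ht1 h1γ (by
    rw [hg]; linarith)
  set W := kk d α 0 t (x - y) with hW
  have hW0 : 0 ≤ W := kk_nonneg _ _ _ _ ht0.le _
  have j2 := Integrable.add i1 i2
  have j3 := Integrable.add j2 i3
  have j4 := Integrable.add j3 i4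
  have j5 := Integrable.add j4 i5
  have hpt : ∀ s ∈ Set.Ioo (0 : ℝ) t, |∫ z, P (t - s) x z * Q s z y| ≤ D * W * M *
      (s ^ ((1 : ℝ) - 1) * (t / 2) ^ (-γ / α - 1) + s ^ (β / α - 1) * (t / 2) ^ (-γ / α)
      + (t - s) ^ ((β - γ) / α - 1) * (t / 2) ^ (0 : ℝ)
      + (t - s) ^ ((β - γ' - γ) / α - 1) * (t / 2) ^ ((γ' - β) / α)
      + (t - s) ^ (1 - γ / α - 1) * (t / 2) ^ (γ' / α - 1)) := by
    rintro s ⟨hs0, hst⟩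
    obtain ⟨a, ha⟩ : ∃ a, a = t - s := ⟨_, rfl⟩
    rw [← ha]
    have ha0 : 0 < a := by linarith
    have has : a + s = t := by linarith
    have ht2 : 0 < t / 2 := by linarith
    have hp : ∀ z, |P a x z| ≤ C₀ * (a ^ (-γ / α) * kk d α 0 a (x - z)) := by
      intro z
      have := h1 a ⟨ha0, by linarith⟩ x z
      rwa [rho_eq] at this
    have hq : ∀ z, |Q s z y| ≤
        C₀ * (kk d α β s (z - y) + s ^ (β / α) * kk d α 0 s (z - y)) := by
      intro z
      have := h3 s ⟨hs0, by linarith⟩ z y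
      rwa [rho_eq, rho_eq, zero_div, Real.rpow_zero, one_mul] at this
    have p1 : 0 ≤ s ^ ((1 : ℝ) - 1) * (t / 2) ^ (-γ / α - 1) := by positivity
    have p2 : 0 ≤ s ^ (β / α - 1) * (t / 2) ^ (-γ / α) := by positivity
    have p3 : 0 ≤ a ^ ((β - γ) / α - 1) * (t / 2) ^ (0 : ℝ) := by positivity
    have p4 : 0 ≤ a ^ ((β - γ' - γ) / α - 1) * (t / 2) ^ ((γ' - β) / α) := by positivity
    have p5 : 0 ≤ a ^ (1 - γ / α - 1) * (t / 2) ^ (γ' / α - 1) := by positivity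
    have hneg : -γ / α ≤ 0 := by rw [hg]; simp; positivity
    rcases lt_or_ge s a with hsa | hsa
    · have key := case1 d α β a s (a ^ (-γ / α)) C₀ hα1 hβ0 (by linarith) ha0 hs0 (by linarith)
        (by positivity) hC₀ x y (fun z => P a x z) (fun z => Q s z y) hp hq
      rw [has, ← hW, ← hD] at key
      have hta : t / 2 ≤ a := by linarith
      have q1 : a ^ (-γ / α) * a ^ (-1 : ℝ) ≤ s ^ ((1 : ℝ) - 1) * (t / 2) ^ (-γ / α - 1) := by
        rw [sub_self, Real.rpow_zero, one_mul, ← Real.rpow_add ha0]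
        exact Real.rpow_le_rpow_of_nonpos ht2 hta (by linarith)
      have q2 : a ^ (-γ / α) * s ^ (β / α - 1) ≤ s ^ (β / α - 1) * (t / 2) ^ (-γ / α) := by
        rw [mul_comm]
        gcongr ?_ * ?_
        exact Real.rpow_le_rpow_of_nonpos ht2 hta hneg
      refine key.trans ?_
      rw [mul_assoc (D * W)]
      gcongr
      have c1 : 2 * JJ d α 0 ≤ M := by rw [hM]; linarith
      have c2 : JJ d α 0 + JJ d α β ≤ M := by rw [hM]; linarith
      have z1 := mul_le_mul c1 q1 (by positivity) hM0.le
      have z2 := mul_le_mul c2 q2 (by positivity) hM0.le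
      have z3 := mul_nonneg hM0.le p3
      have z4 := mul_nonneg hM0.le p4
      have z5 := mul_nonneg hM0.le p5
      linarith
    · have key := case2 d α β γ' a s (a ^ (-γ / α)) (a ^ ((β - γ) / α - 1)) C₀ hα1 hβ0
        (by linarith) hγ'0 (by linarith) ha0 hs0 (by linarith) hsa
        (by positivity) (by positivity) hC₀ x y (fun z => P a x z) (fun z => Q s z y)
        (hP.comp (by fun_prop : Measurable fun z : Euc d => (a, x, z)))
        (hQ.comp (by fun_prop : Measurable fun z : Euc d => (s, z, y))) hp
        (h2 a ⟨ha0, by linarith⟩ x) hq (by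
          intro z
          have := h4 s ⟨hs0, by linarith⟩ x z y
          simpa only [rho_eq] using this)
      rw [has, ← hW, ← hD] at key
      have hts : t / 2 ≤ s := by linarith
      have q3 : a ^ ((β - γ) / α - 1) ≤ a ^ ((β - γ) / α - 1) * (t / 2) ^ (0 : ℝ) := by
        rw [Real.rpow_zero, mul_one]
      have q4 : a ^ (-γ / α) * a ^ ((β - γ') / α - 1) * s ^ ((γ' - β) / α) ≤
          a ^ ((β - γ' - γ) / α - 1) * (t / 2) ^ ((γ' - β) / α) := by
        rw [← Real.rpow_add ha0]
        have : -γ / α + ((β - γ') / α - 1) = (β - γ' - γ) / α - 1 := by ring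
        rw [this]
        gcongr ?_ * ?_
        exact Real.rpow_le_rpow_of_nonpos ht2 hts
          (div_nonpos_of_nonpos_of_nonneg (by linarith) hα0.le)
      have q5 : a ^ (-γ / α) * s ^ (γ' / α - 1) ≤
          a ^ (1 - γ / α - 1) * (t / 2) ^ (γ' / α - 1) := by
        have : 1 - γ / α - 1 = -γ / α := by ring
        rw [this]
        gcongr ?_ * ?_
        refine Real.rpow_le_rpow_of_nonpos ht2 hts ?_
        have : γ' / α < 1 := by rw [div_lt_one hα0]; linarith
        linarith
      refine key.trans ?_
      rw [mul_assoc (D * W)]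
      gcongr
      have c1 : 2 ≤ M := by rw [hM]; linarith
      have c2 : JJ d α 0 + JJ d α β ≤ M := by rw [hM]; linarith
      have c3 : 4 * JJ d α (β - γ') ≤ M := by rw [hM]; linarith
      have z1 := mul_le_mul c1 q3 (by positivity) hM0.le
      have z2 := mul_le_mul c3 q4 (by positivity) hM0.le
      have z3 := mul_le_mul c2 q5 (by positivity) hM0.le
      have z4 := mul_nonneg hM0.le p1
      have z5 := mul_nonneg hM0.le p2
      linarith
  have hfin := norm_integral_le_of_norm_le
    (f := fun s => ∫ z, P (t - s) x z * Q s z y) (j5.const_mul (D * W * M))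
    ((ae_restrict_iff' measurableSet_Ioo).2 (Filter.Eventually.of_forall hpt))
  rw [Real.norm_eq_abs] at hfin
  refine hfin.trans ?_
  rw [integral_const_mul, integral_add' j4 i5, integral_add' j3 i4, integral_add' j2 i3,
    integral_add' i1 i2, rho_eq, ← hW]
  calc _ ≤ D * W * M * (N * t ^ (-γ / α)) := by
        gcongr
        rw [hN]
        linarith
    _ = _ := by ring
end

section
/- Let d ≥ 1, α ∈ (1,2), and let K : (0,∞) × ℝ^d × ℝ^d → ℝ^d be measurable such that for some C₀ > 0: (i) ∫_{ℝ^d} K(t,x,y) dy = 0 for all t > 0, x ∈ ℝ^d; (ii) |K(t,x,y)| ≤ C₀ · ϱ_{α−1}^0(t, x−y) for all t > 0 and x, y ∈ ℝ^d. Then for every ϑ ∈ (0,1) there exists a constant C > 0 such that for every bounded measurable f : ℝ^d → ℝ with [f]_ϑ := sup_{x ≠ y} |f(x)−f(y)|/|x−y|^ϑ < ∞, and for all t > 0 and x ∈ ℝ^d, | ∫_{ℝ^d} K(t,x,y) f(y) dy | ≤ C · t^{(ϑ−1)/α} · [f]_ϑ. -/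
open MeasureTheory

lemma aux_int (d : ℕ) (r s : ℝ) (hr : (d : ℝ) < r) (hs : 0 < s) :
    Integrable (fun z : Euc d => (‖z‖ + s) ^ (-r)) ∧
    ∫ z : Euc d, (‖z‖ + s) ^ (-r) = s ^ ((d : ℝ) - r) * ∫ z : Euc d, (1 + ‖z‖) ^ (-r) := by
  have hI : Integrable (fun z : Euc d => (1 + ‖z‖) ^ (-r)) := by
    apply integrable_one_add_norm
    simpa using hr
  have heq : (fun z : Euc d => (‖z‖ + s) ^ (-r)) =
      fun z : Euc d => s ^ (-r) * (fun w : Euc d => (1 + ‖w‖) ^ (-r)) (s⁻¹ • z) := by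
    funext z
    simp only [norm_smul, norm_inv, Real.norm_eq_abs, abs_of_pos hs]
    rw [← Real.mul_rpow hs.le (by positivity)]
    congr 1
    field_simp
    ring
  constructor
  · rw [heq]
    exact ((integrable_comp_smul_iff volume _ (inv_ne_zero hs.ne')).2 hI).const_mul _
  · rw [heq, integral_const_mul, 
      Measure.integral_comp_smul volume (fun w : Euc d => (1 + ‖w‖) ^ (-r)) s⁻¹]
    simp only [finrank_euclideanSpace, Fintype.card_fin, smul_eq_mul]
    rw [← mul_assoc]
    congr 1
    rw [abs_of_pos (by positivity), sub_eq_neg_add, Real.rpow_add hs, Real.rpow_natCast]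
    simp

theorem stmt6 (d : ℕ) (hd : 1 ≤ d) (α : ℝ) (hα : α ∈ Set.Ioo (1 : ℝ) 2)
    (K : ℝ → Euc d → Euc d → Euc d)
    (hK : Measurable fun r : ℝ × Euc d × Euc d => K r.1 r.2.1 r.2.2)
    (C₀ : ℝ) (hC₀ : 0 < C₀)
    (hzero : ∀ t > (0 : ℝ), ∀ x : Euc d, ∫ y, K t x y = 0)
    (hbound : ∀ t > (0 : ℝ), ∀ x y : Euc d, ‖K t x y‖ ≤ C₀ * rho d α (α - 1) 0 t (x - y)) :
    ∀ ϑ ∈ Set.Ioo (0 : ℝ) 1, ∃ C > (0 : ℝ),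
      ∀ f : Euc d → ℝ, Measurable f → (∃ M, ∀ x, |f x| ≤ M) →
        ∀ L : ℝ, (∀ x y, |f x - f y| ≤ L * ‖x - y‖ ^ ϑ) →
          ∀ t > (0 : ℝ), ∀ x : Euc d,
            ‖∫ y, f y • K t x y‖ ≤ C * t ^ ((ϑ - 1) / α) * L := by
  intro ϑ hϑ
  obtain ⟨h1, h2⟩ := hα
  obtain ⟨hϑ0, hϑ1⟩ := hϑ
  set I : ℝ := ∫ z : Euc d, (1 + ‖z‖) ^ (-((d : ℝ) + α - ϑ)) with hIdef
  have hI0 : 0 ≤ I := integral_nonneg fun z => by positivity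
  refine ⟨C₀ * I + 1, by positivity, ?_⟩
  intro f hf hfb L hL t ht x
  obtain ⟨M, hM⟩ := hfb
  have hL0 : 0 ≤ L := by
    have := hL (EuclideanSpace.single (⟨0, hd⟩ : Fin d) (1 : ℝ)) 0
    simp only [sub_zero, EuclideanSpace.norm_single, norm_one, Real.one_rpow, mul_one] at this
    exact (abs_nonneg _).trans this
  have hs : 0 < t ^ (1 / α) := Real.rpow_pos_of_pos ht _
  set s := t ^ (1 / α) with hsdef
  have hb : ∀ y, ‖K t x y‖ ≤ C₀ * (t ^ ((α - 1) / α) * (‖x - y‖ + s) ^ (-((d : ℝ) + α))) := by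
    intro y
    have := hbound t ht x y
    simp only [rho, Real.rpow_zero, min_self, mul_one] at this
    rwa [← hsdef, show -(d : ℝ) - α = -((d : ℝ) + α) by ring] at this
  obtain ⟨i1, -⟩ := aux_int d ((d : ℝ) + α) s (by linarith) hs
  obtain ⟨i2, e2⟩ := aux_int d ((d : ℝ) + α - ϑ) s (by linarith) hs
  have hKm : Measurable (fun y => K t x y) :=
    hK.comp (measurable_const.prodMk (measurable_const.prodMk measurable_id))
  have hKi : Integrable (fun y => K t x y) := by
    refine Integrable.mono' (((i1.comp_sub_left x).const_mul (t ^ ((α - 1) / α))).const_mul C₀)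
      hKm.aestronglyMeasurable (Filter.Eventually.of_forall hb)
  have hfK : Integrable (fun y => f y • K t x y) :=
    hKi.bdd_smul M hf.aestronglyMeasurable (Filter.Eventually.of_forall hM)
  have e : ∫ y, f y • K t x y = ∫ y, (f y - f x) • K t x y := by
    simp only [sub_smul]
    have hfx : Integrable (fun y => f x • K t x y) := hKi.smul (f x)
    rw [integral_sub hfK hfx, integral_smul, hzero t ht x]
    simp
  rw [e]
  have key : ‖∫ y, (f y - f x) • K t x y‖ ≤
      ∫ y, L * C₀ * t ^ ((α - 1) / α) * (‖x - y‖ + s) ^ (-((d : ℝ) + α - ϑ)) := by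
    refine norm_integral_le_of_norm_le ((i2.comp_sub_left x).const_mul _)
      (Filter.Eventually.of_forall fun y => ?_)
    rw [norm_smul, Real.norm_eq_abs]
    have hp : 0 < ‖x - y‖ + s := by positivity
    have a1 : |f y - f x| ≤ L * (‖x - y‖ + s) ^ ϑ := by
      refine (hL y x).trans ?_
      rw [norm_sub_rev]
      gcongr
      linarith
    calc _ ≤ (L * (‖x - y‖ + s) ^ ϑ) *
          (C₀ * (t ^ ((α - 1) / α) * (‖x - y‖ + s) ^ (-((d : ℝ) + α)))) := by
          gcongr
          exact hb y
      _ = _ := by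
          rw [show -((d : ℝ) + α - ϑ) = ϑ + -((d : ℝ) + α) by ring, Real.rpow_add hp]
          ring
  refine key.trans ?_
  rw [integral_const_mul,
    integral_sub_left_eq_self (fun z : Euc d => (‖z‖ + s) ^ (-((d : ℝ) + α - ϑ))) volume x, e2,
    ← hIdef]
  have hexp : t ^ ((α - 1) / α) * s ^ ((d : ℝ) - (d + α - ϑ)) = t ^ ((ϑ - 1) / α) := by
    rw [hsdef, ← Real.rpow_mul ht.le, ← Real.rpow_add ht]
    congr 1
    field_simp
    ring
  have hT : 0 ≤ t ^ ((ϑ - 1) / α) := by positivity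
  calc _ = C₀ * I * (t ^ ((α - 1) / α) * s ^ ((d : ℝ) - (d + α - ϑ))) * L := by ring
    _ ≤ _ := by
      rw [hexp]
      gcongr
      linarith
end

section
/- Let d ≥ 1, α ∈ (1,2), β₂ ∈ [0, α−1), and p ∈ (1,∞). Let K : (0,1] × ℝ^d × ℝ^d → ℝ be measurable such that for some C₀ > 0: (i) ∫_{ℝ^d} K(t,x,y) dy = 0 for all t ∈ (0,1], x ∈ ℝ^d; (ii) |K(t,x,y)| ≤ C₀ · ϱ_{α−1−β₂}^0(t, x−y) for all t ∈ (0,1] and x, y ∈ ℝ^d. Then there exists a constant C > 0 such that for every f ∈ C_c^∞(ℝ^d) and every t ∈ (0,1], ‖ x ↦ ∫_{ℝ^d} K(t,x,y) f(y) dy ‖_{L^p(ℝ^d)} ≤ C · t^{−β₂/α} · ‖ ∇f ‖_{L^p(ℝ^d)}. -/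
open MeasureTheory

theorem minkA {E Ω : Type*} [MeasurableSpace Ω] [AddCommGroup E] [MeasurableSpace E] [MeasurableAdd₂ E] 
    (μ : Measure E) [SFinite μ] [μ.IsAddRightInvariant]
    (ν : Measure Ω) [SFinite ν] (G : E → ENNReal) (hG : Measurable G) (φ : Ω → E)
    (hφ : Measurable φ) (p : ℝ) (hp : 1 < p) :
    ∫⁻ x, (∫⁻ ω, G (x + φ ω) ∂ν) ^ p ∂μ ≤ (ν Set.univ) ^ p * ∫⁻ x, G x ^ p ∂μ := by
  have hpq : p.HolderConjugate (Real.conjExponent p) := Real.HolderConjugate.conjExponent hp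
  set q := Real.conjExponent p
  have hp0 : 0 < p := by linarith
  have h1 : ∀ x, (∫⁻ ω, G (x + φ ω) ∂ν) ^ p ≤ (ν Set.univ) ^ (p - 1) * ∫⁻ ω, G (x + φ ω) ^ p ∂ν := by
    intro x
    have := ENNReal.lintegral_mul_le_Lp_mul_Lq ν hpq (f := fun ω => G (x + φ ω)) (g := fun _ => 1)
      (by fun_prop) (by fun_prop)
    simp only [Pi.mul_apply, mul_one, ENNReal.one_rpow, lintegral_const, one_mul] at this
    calc _ ≤ _ := ENNReal.rpow_le_rpow this hp0.le
      _ = _ := by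
        rw [ENNReal.mul_rpow_of_nonneg _ _ hp0.le, ← ENNReal.rpow_mul, ← ENNReal.rpow_mul, mul_comm]
        congr 2
        · rw [one_div, inv_mul_eq_div]
          have := hpq.sub_one_mul_conj
          have := hpq.symm.pos
          field_simp
          linarith
        · simp [hp0.ne']
  calc _ ≤ ∫⁻ x, (ν Set.univ) ^ (p - 1) * ∫⁻ ω, G (x + φ ω) ^ p ∂ν ∂μ := lintegral_mono h1
    _ = (ν Set.univ) ^ (p - 1) * ∫⁻ x, ∫⁻ ω, G (x + φ ω) ^ p ∂ν ∂μ := by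
      rw [lintegral_const_mul]
      apply Measurable.lintegral_prod_right'  (f := fun z : E × Ω => G (z.1 + φ z.2) ^ p)
      fun_prop
    _ = (ν Set.univ) ^ (p - 1) * ∫⁻ ω, ∫⁻ x, G (x + φ ω) ^ p ∂μ ∂ν := by
      rw [lintegral_lintegral_swap]
      apply Measurable.aemeasurable
      show Measurable (fun z : E × Ω => G (z.1 + φ z.2) ^ p)
      fun_prop
    _ = (ν Set.univ) ^ (p - 1) * (ν Set.univ * ∫⁻ x, G x ^ p ∂μ) := by
      have : ∀ ω, ∫⁻ x, G (x + φ ω) ^ p ∂μ = ∫⁻ x, G x ^ p ∂μ := fun ω =>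
        lintegral_add_right_eq_self (fun x => G x ^ p) (φ ω)
      simp only [this, lintegral_const]
      rw [mul_comm (ν Set.univ) (∫⁻ x, G x ^ p ∂μ)]
    _ = _ := by
      rw [← mul_assoc]
      congr 1
      conv_lhs => rw [← ENNReal.rpow_one (ν Set.univ), ← ENNReal.rpow_mul, one_mul]
      rw [← ENNReal.rpow_add_of_nonneg _ _ (by linarith) (by norm_num)]
      simp

theorem ftcB {E : Type*} [NormedAddCommGroup E] [NormedSpace ℝ E] (f : E → ℝ) (hf : ContDiff ℝ (⊤ : ℕ∞) f)
    (x z : E) : ‖f (x + z) - f x‖ₑ ≤ ‖z‖ₑ * ∫⁻ s in Set.Ioc (0:ℝ) 1, ‖fderiv ℝ f (x + s • z)‖ₑ := by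
  have hd : Differentiable ℝ f := hf.differentiable (by simp)
  have hc : Continuous (fderiv ℝ f) := hf.continuous_fderiv (by simp)
  have h : ∫ s in (0:ℝ)..1, fderiv ℝ f (x + s • z) z = f (x + (1:ℝ) • z) - f (x + (0:ℝ) • z) := by
    apply intervalIntegral.integral_eq_sub_of_hasDerivAt (f := fun s : ℝ => f (x + s • z))
    · intro s _
      have h1 : HasDerivAt (fun s : ℝ => x + s • z) z s := by
        simpa using ((hasDerivAt_id s).smul_const z).const_add x
      exact (hd _).hasFDerivAt.comp_hasDerivAt s h1
    · apply Continuous.intervalIntegrable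
      fun_prop
  simp only [one_smul, zero_smul, add_zero] at h
  rw [← h, intervalIntegral.integral_of_le zero_le_one]
  refine (enorm_integral_le_lintegral_enorm _).trans ?_
  rw [← lintegral_const_mul _ (Continuous.measurable (by fun_prop))]
  apply lintegral_mono
  intro s
  beta_reduce
  rw [mul_comm]
  exact ContinuousLinearMap.le_opNorm_enorm _ _

theorem scaleC (d : ℕ) (a r : ℝ) (ha : (d:ℝ) < a) (hr : 0 < r) :
    Integrable (fun z : EuclideanSpace ℝ (Fin d) => (‖z‖ + r) ^ (-a)) ∧
    ∫ z : EuclideanSpace ℝ (Fin d), (‖z‖ + r) ^ (-a) =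
      r ^ ((d:ℝ) - a) * ∫ z : EuclideanSpace ℝ (Fin d), (1 + ‖z‖) ^ (-a) := by
  have e : ∀ z : EuclideanSpace ℝ (Fin d), (‖z‖ + r) ^ (-a) = r ^ (-a) * (1 + ‖r⁻¹ • z‖) ^ (-a) := by
    intro z
    rw [← Real.mul_rpow hr.le (by positivity), norm_smul, Real.norm_of_nonneg (by positivity)]
    congr 1
    field_simp
    ring
  have hi : Integrable (fun z : EuclideanSpace ℝ (Fin d) => (1 + ‖z‖) ^ (-a)) := by
    apply integrable_one_add_norm
    simpa using ha
  constructor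
  · simp_rw [e]
    exact (hi.comp_smul (inv_ne_zero hr.ne')).const_mul _
  · simp_rw [e]
    rw [integral_const_mul, Measure.integral_comp_inv_smul_of_nonneg volume (fun z : EuclideanSpace ℝ (Fin d) => (1 + ‖z‖) ^ (-a)) hr.le]
    rw [smul_eq_mul, ← mul_assoc, finrank_euclideanSpace_fin, ← Real.rpow_natCast, ← Real.rpow_add hr]
    ring_nf


open MeasureTheory

theorem stmt8 (d : ℕ) (hd : 1 ≤ d) (α β₂ : ℝ) (hα : α ∈ Set.Ioo (1 : ℝ) 2)
    (hβ₂ : β₂ ∈ Set.Ico (0 : ℝ) (α - 1)) (p : ℝ) (hp : 1 < p)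
    (K : ℝ → Euc d → Euc d → ℝ)
    (hK : Measurable fun r : ℝ × Euc d × Euc d => K r.1 r.2.1 r.2.2)
    (C₀ : ℝ) (hC₀ : 0 < C₀)
    (hzero : ∀ t ∈ Set.Ioc (0 : ℝ) 1, ∀ x : Euc d, ∫ y, K t x y = 0)
    (hbound : ∀ t ∈ Set.Ioc (0 : ℝ) 1, ∀ x y : Euc d,
      |K t x y| ≤ C₀ * rho d α (α - 1 - β₂) 0 t (x - y)) :
    ∃ C > (0 : ℝ), ∀ f : Euc d → ℝ, ContDiff ℝ (⊤ : ℕ∞) f → HasCompactSupport f →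
      ∀ t ∈ Set.Ioc (0 : ℝ) 1,
        eLpNorm (fun x => ∫ y, K t x y * f y) (ENNReal.ofReal p) volume
          ≤ ENNReal.ofReal (C * t ^ (-β₂ / α)) *
            eLpNorm (fun x => fderiv ℝ f x) (ENNReal.ofReal p) volume := by
  obtain ⟨hα1, hα2⟩ := hα
  obtain ⟨hβ0, hβ1⟩ := hβ₂
  set I : ℝ := ∫ z : Euc d, (1 + ‖z‖) ^ (-((d:ℝ) + α - 1)) with hI
  have hI0 : 0 ≤ I := integral_nonneg fun z => by positivity
  refine ⟨C₀ * (I + 1), by positivity, ?_⟩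
  intro f hf hfc t ht
  have ht0 : 0 < t := ht.1
  set r : ℝ := t ^ (1 / α) with hr
  have hr0 : 0 < r := Real.rpow_pos_of_pos ht0 _
  have hα0 : 0 < α := by linarith
  have hfcont : Continuous f := hf.continuous
  have hc : Continuous (fderiv ℝ f) := hf.continuous_fderiv (by simp)
  set A : ℝ := C₀ * t ^ ((α - 1 - β₂) / α) with hA
  have hA0 : 0 < A := by positivity
  have hb : ∀ x y : Euc d, |K t x y| ≤ A * (‖x - y‖ + r) ^ (-((d:ℝ) + α)) := by
    intro x y
    refine (hbound t ht x y).trans (le_of_eq ?_)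
    rw [rho, Real.rpow_zero, min_self, mul_one, ← mul_assoc, neg_add']
  -- integrability of the kernel
  have hKm : ∀ x, Measurable (K t x) := fun x =>
    hK.comp (measurable_const.prodMk (measurable_const.prodMk measurable_id))
  have hKi : ∀ x, Integrable (K t x) := by
    intro x
    have h1 := ((scaleC d ((d:ℝ) + α) r (by linarith) hr0).1.comp_sub_left x).const_mul A
    refine h1.mono' (hKm x).aestronglyMeasurable (Filter.Eventually.of_forall fun y => ?_)
    exact hb x y
  have hKf : ∀ x, Integrable (fun y => K t x y * f y) := by
    intro x
    obtain ⟨B, hB⟩ := hfc.exists_bound_of_continuous hfcont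
    exact (hKi x).mul_bdd (c := B) hfcont.aestronglyMeasurable (Filter.Eventually.of_forall hB)
  -- the weight
  set w : Euc d → ℝ := fun z => A * (‖z‖ + r) ^ (-((d:ℝ) + α - 1)) with hw
  have hwm : Measurable w := by fun_prop
  set W : Euc d → ENNReal := fun z => ENNReal.ofReal (w z) with hW
  have hWm : Measurable W := hwm.ennreal_ofReal
  have hWint : ∫⁻ z, W z ≤ ENNReal.ofReal (C₀ * (I + 1) * t ^ (-β₂ / α)) := by
    obtain ⟨h1, h2⟩ := scaleC d ((d:ℝ) + α - 1) r (by linarith) hr0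
    rw [← ofReal_integral_eq_lintegral_ofReal (h1.const_mul A)
      (Filter.Eventually.of_forall fun z => by positivity)]
    apply ENNReal.ofReal_le_ofReal
    rw [integral_const_mul, h2, ← hI]
    have h3 : t ^ ((α - 1 - β₂) / α) * r ^ ((d:ℝ) - ((d:ℝ) + α - 1)) = t ^ (-β₂ / α) := by
      rw [hr, ← Real.rpow_mul ht0.le, ← Real.rpow_add ht0]
      congr 1
      field_simp
      ring
    have h4 : A * (r ^ ((d:ℝ) - ((d:ℝ) + α - 1)) * I) = C₀ * I * t ^ (-β₂ / α) := by
      rw [hA, ← h3]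
      ring
    rw [h4]
    have : 0 < t ^ (-β₂ / α) := by positivity
    gcongr
    linarith
  have hKW : ∀ x z, ‖K t x (x + z)‖ₑ * ‖z‖ₑ ≤ W z := by
    intro x z
    rw [← enorm_norm z, ← enorm_mul, ← ofReal_norm_eq_enorm]
    apply ENNReal.ofReal_le_ofReal
    rw [norm_mul, norm_norm, Real.norm_eq_abs]
    have h1 := hb x (x + z)
    rw [sub_add_cancel_left, norm_neg] at h1
    have h2 : 0 < ‖z‖ + r := by positivity
    calc _ ≤ A * (‖z‖ + r) ^ (-((d:ℝ) + α)) * (‖z‖ + r) := by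
          gcongr
          linarith
      _ = _ := by
          rw [hw, mul_assoc]
          congr 1
          conv_lhs => rw [← Real.rpow_one (‖z‖ + r), ← Real.rpow_mul h2.le, one_mul]
          rw [← Real.rpow_add h2]
          congr 1
          ring
  set ν : Measure (Euc d × ℝ) :=
    (volume.withDensity W).prod (volume.restrict (Set.Ioc (0:ℝ) 1)) with hν
  set G : Euc d → ENNReal := fun x => ‖fderiv ℝ f x‖ₑ with hG
  have hGm : Measurable G := hc.enorm.measurable
  have hφ : Measurable (fun o : Euc d × ℝ => o.2 • o.1) := by fun_prop
  have hνu : ν Set.univ ≤ ENNReal.ofReal (C₀ * (I + 1) * t ^ (-β₂ / α)) := by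
    rw [hν, ← Set.univ_prod_univ, Measure.prod_prod]
    simpa using hWint
  have hpt : ∀ x, ‖∫ y, K t x y * f y‖ₑ ≤ ∫⁻ o, G (x + o.2 • o.1) ∂ν := by
    intro x
    have h1 : ∫ y, K t x y * f y = ∫ y, K t x y * (f y - f x) := by
      simp_rw [mul_sub]
      rw [integral_sub (hKf x) ((hKi x).mul_const _), integral_mul_const, hzero t ht x]
      simp
    have hm : Measurable fun o : Euc d × ℝ => G (x + o.2 • o.1) := by fun_prop
    rw [h1]
    calc _ ≤ ∫⁻ y, ‖K t x y * (f y - f x)‖ₑ := enorm_integral_le_lintegral_enorm _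
      _ = ∫⁻ z, ‖K t x (x + z) * (f (x + z) - f x)‖ₑ :=
        (lintegral_add_left_eq_self (fun y => ‖K t x y * (f y - f x)‖ₑ) x).symm
      _ ≤ ∫⁻ z, W z * ∫⁻ s in Set.Ioc (0:ℝ) 1, G (x + s • z) := by
        apply lintegral_mono
        intro z
        beta_reduce
        rw [enorm_mul]
        calc _ ≤ ‖K t x (x + z)‖ₑ * (‖z‖ₑ * ∫⁻ s in Set.Ioc (0:ℝ) 1, G (x + s • z)) := by
              gcongr
              exact ftcB f hf x z
          _ ≤ _ := by
              rw [← mul_assoc]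
              gcongr
              exact hKW x z
      _ = ∫⁻ z, (∫⁻ s in Set.Ioc (0:ℝ) 1, G (x + s • z)) ∂(volume.withDensity W) := by
        rw [lintegral_withDensity_eq_lintegral_mul _ hWm]
        · rfl
        · exact hm.lintegral_prod_right'
      _ = _ := by
        rw [hν, lintegral_prod _ hm.aemeasurable]
  have hp0 : 0 < p := by linarith
  have hpz : ENNReal.ofReal p ≠ 0 := by simpa using hp0
  rw [eLpNorm_eq_lintegral_rpow_enorm_toReal hpz ENNReal.ofReal_ne_top,
    eLpNorm_eq_lintegral_rpow_enorm_toReal hpz ENNReal.ofReal_ne_top,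
    ENNReal.toReal_ofReal hp0.le]
  set D := ENNReal.ofReal (C₀ * (I + 1) * t ^ (-β₂ / α)) with hD
  have key : ∫⁻ x, ‖∫ y, K t x y * f y‖ₑ ^ p ≤ D ^ p * ∫⁻ x, ‖fderiv ℝ f x‖ₑ ^ p := by
    calc _ ≤ ∫⁻ x, (∫⁻ o, G (x + o.2 • o.1) ∂ν) ^ p :=
          lintegral_mono fun x => ENNReal.rpow_le_rpow (hpt x) hp0.le
      _ ≤ (ν Set.univ) ^ p * ∫⁻ x, G x ^ p := minkA volume ν G hGm _ hφ p hp
      _ ≤ _ := by gcongr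
  calc _ ≤ (D ^ p * ∫⁻ x, ‖fderiv ℝ f x‖ₑ ^ p) ^ (1 / p) :=
        ENNReal.rpow_le_rpow key (by positivity)
    _ = _ := by
      rw [ENNReal.mul_rpow_of_nonneg _ _ (by positivity), ← ENNReal.rpow_mul,
        mul_one_div_cancel hp0.ne', ENNReal.rpow_one]
end

section
/- Let d ≥ 1, α ∈ (1,2), ϑ ∈ (0, 2−α), ϑ' ∈ (α+ϑ−1, 1), λ > 0 and A > 0. Let g : (0,∞) × ℝ^d → ℝ^d be measurable and satisfy, for all t > 0 and x, y ∈ ℝ^d: |g(t,x)| ≤ A t^{(ϑ−1)/α} and |g(t,x) − g(t,y)| ≤ A |x−y|^{ϑ'} t^{(ϑ−ϑ'−1)/α}. Then G(x) := ∫₀^∞ e^{−λt} g(t,x) dt is well-defined (the integral converges absolutely), and there exists a constant C = C(α, ϑ, ϑ') > 0 such that for all x, y ∈ ℝ^d, |G(x) − G(y)| ≤ C · A · |x−y|^{α+ϑ−1}. -/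
open MeasureTheory

theorem stmt13 (d : ℕ) (hd : 1 ≤ d) (α ϑ ϑ' : ℝ)
    (hα : α ∈ Set.Ioo (1 : ℝ) 2) (hϑ : ϑ ∈ Set.Ioo (0 : ℝ) (2 - α))
    (hϑ' : ϑ' ∈ Set.Ioo (α + ϑ - 1) 1) :
    ∃ C > (0 : ℝ), ∀ lam > (0 : ℝ), ∀ A > (0 : ℝ), ∀ g : ℝ → Euc d → Euc d,
      (∀ x : Euc d, AEStronglyMeasurable (fun t => g t x) (volume.restrict (Set.Ioi 0))) →
      (∀ t > (0 : ℝ), ∀ x : Euc d, ‖g t x‖ ≤ A * t ^ ((ϑ - 1) / α)) →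
      (∀ t > (0 : ℝ), ∀ x y : Euc d,
        ‖g t x - g t y‖ ≤ A * ‖x - y‖ ^ ϑ' * t ^ ((ϑ - ϑ' - 1) / α)) →
      (∀ x : Euc d, IntegrableOn (fun t => Real.exp (-(lam * t)) • g t x) (Set.Ioi 0)) ∧
      ∀ x y : Euc d,
        ‖(∫ t in Set.Ioi (0 : ℝ), Real.exp (-(lam * t)) • g t x)
            - ∫ t in Set.Ioi (0 : ℝ), Real.exp (-(lam * t)) • g t y‖
          ≤ C * A * ‖x - y‖ ^ (α + ϑ - 1) := by
  obtain ⟨ha1, ha2⟩ := hα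
  obtain ⟨ht1, ht2⟩ := hϑ
  obtain ⟨hs1, hs2⟩ := hϑ'
  have ha : 0 < α := by linarith
  set p := (ϑ - 1) / α with hp
  set q := (ϑ - ϑ' - 1) / α with hq
  have hpa : α * p = ϑ - 1 := by rw [hp]; field_simp
  have hqa : α * q = ϑ - ϑ' - 1 := by rw [hq]; field_simp
  have hp1 : -1 < p := by nlinarith
  have hq1 : q < -1 := by nlinarith
  have hc1 : 0 < 2 / (p + 1) := div_pos two_pos (by linarith)
  have hc2 : 0 < 1 / (-(q + 1)) := div_pos one_pos (by linarith)
  refine ⟨2 / (p + 1) + 1 / (-(q + 1)), by positivity, ?_⟩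
  intro lam hlam A hA g hm hb hh
  have hgInt : ∀ x : Euc d,
      IntegrableOn (fun t => Real.exp (-(lam * t)) • g t x) (Set.Ioi 0) := by
    intro x
    have h0 := (integrableOn_rpow_mul_exp_neg_mul_rpow hp1 one_pos hlam).const_mul A
    refine Integrable.mono' h0 ?_ ?_
    · have hc : Continuous (fun t : ℝ => Real.exp (-(lam * t))) := by fun_prop
      exact hc.aestronglyMeasurable.smul (hm x)
    · filter_upwards [ae_restrict_mem measurableSet_Ioi] with t ht
      rw [norm_smul, Real.norm_eq_abs, Real.abs_exp, Real.rpow_one]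
      have h1 := mul_le_mul_of_nonneg_left (hb t ht x) (Real.exp_pos (-(lam * t))).le
      rw [neg_mul]
      linarith
  refine ⟨hgInt, fun x y => ?_⟩
  rcases eq_or_ne x y with rfl | hxy
  · rw [sub_self, norm_zero]
    positivity
  have hr : 0 < ‖x - y‖ := norm_pos_iff.2 (sub_ne_zero.2 hxy)
  set r := ‖x - y‖ with hrdef
  have hT : 0 < r ^ α := Real.rpow_pos_of_pos hr _
  set T := r ^ α with hTdef
  rw [← integral_sub (hgInt x) (hgInt y)]
  have hd' : IntegrableOn (fun t => Real.exp (-(lam * t)) • g t x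
      - Real.exp (-(lam * t)) • g t y) (Set.Ioi 0) := (hgInt x).sub (hgInt y)
  have hkey : ∀ t > 0, ‖Real.exp (-(lam * t)) • g t x - Real.exp (-(lam * t)) • g t y‖
      ≤ ‖g t x - g t y‖ := by
    intro t ht
    rw [← smul_sub, norm_smul, Real.norm_eq_abs, Real.abs_exp]
    have : Real.exp (-(lam * t)) ≤ 1 := Real.exp_le_one_iff.2 (by nlinarith)
    exact mul_le_of_le_one_left (norm_nonneg _) this
  have hU : Set.Ioi (0 : ℝ) = Set.Ioc 0 T ∪ Set.Ioi T := (Set.Ioc_union_Ioi_eq_Ioi hT.le).symm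
  rw [hU, setIntegral_union (Set.Ioc_disjoint_Ioi le_rfl) measurableSet_Ioi
    (hd'.mono_set Set.Ioc_subset_Ioi_self) (hd'.mono_set (Set.Ioi_subset_Ioi hT.le))]
  have hi1 : IntegrableOn (fun t : ℝ => t ^ p) (Set.Ioc 0 T) :=
    (intervalIntegrable_iff_integrableOn_Ioc_of_le hT.le).1
      (intervalIntegral.intervalIntegrable_rpow' hp1)
  have e1 : ‖∫ t in Set.Ioc 0 T, (Real.exp (-(lam * t)) • g t x
      - Real.exp (-(lam * t)) • g t y)‖ ≤ ∫ t in Set.Ioc 0 T, (2 * A) * t ^ p := by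
    refine norm_integral_le_of_norm_le (hi1.const_mul _) ?_
    filter_upwards [ae_restrict_mem measurableSet_Ioc] with t ht
    have h1 := hkey t ht.1
    have h2 := norm_sub_le (g t x) (g t y)
    have h3 := hb t ht.1 x
    have h4 := hb t ht.1 y
    linarith
  have e2 : ‖∫ t in Set.Ioi T, (Real.exp (-(lam * t)) • g t x
      - Real.exp (-(lam * t)) • g t y)‖ ≤ ∫ t in Set.Ioi T, (A * r ^ ϑ') * t ^ q := by
    refine norm_integral_le_of_norm_le ((integrableOn_Ioi_rpow_of_lt hq1 hT).const_mul _) ?_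
    filter_upwards [ae_restrict_mem measurableSet_Ioi] with t ht
    have ht0 : 0 < t := hT.trans ht
    exact (hkey t ht0).trans (hh t ht0 x y)
  have hI1 : ∫ t in Set.Ioc 0 T, t ^ p = T ^ (p + 1) / (p + 1) := by
    rw [← intervalIntegral.integral_of_le hT.le, integral_rpow (Or.inl hp1),
      Real.zero_rpow (by linarith), sub_zero]
  rw [integral_const_mul, hI1] at e1
  rw [integral_const_mul, integral_Ioi_rpow_of_lt hq1 hT] at e2
  have hT1 : T ^ (p + 1) = r ^ (α + ϑ - 1) := by
    rw [hTdef, ← Real.rpow_mul hr.le]; congr 1; linarith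
  have hT2 : r ^ ϑ' * T ^ (q + 1) = r ^ (α + ϑ - 1) := by
    rw [hTdef, ← Real.rpow_mul hr.le, ← Real.rpow_add hr]; congr 1; linarith
  refine (norm_add_le _ _).trans ((add_le_add e1 e2).trans (le_of_eq ?_))
  rw [hT1]
  have : A * r ^ ϑ' * (-T ^ (q + 1) / (q + 1)) = A * (r ^ ϑ' * T ^ (q + 1)) * (1 / (-(q + 1))) := by
    rw [one_div, inv_neg]; ring
  rw [this, hT2]
  ring
end
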